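/- Let m ≥ 1 and a, b_1,…,b_m, c_1,…,c_m ∈ ℂ with a ≠ 0, β_{0,i} = b_i ≠ 0, β_{1,i} = c_i − 1 − b_i ≠ 0 for all i, and γ_w = a − Σ_i w_i c_i + |w| ≠ 0 for all w ∈ {0,1}^m. Let C be the {0,1}^m-indexed matrix with C_{v,v'} = Σ_{w∈{0,1}^m} A_w ∏_{i: w_i=0} δ(v_i,v'_i)/β_{v_i,i} (A_w the sum over maximal chains below w of ∏_j 1/γ_{w^{(j)}}, A_{(0,…,0)} = 1); (e_v) the standard row basis of ℂ^{2^m}; σ_j·v the flip of the j-th coordinate of v; Σβ_v = Σ_i β_{v_i,i}; Πβ_v = ∏_i β_{v_i,i}; f_v = ((a − Σβ_v)/a) e_v − Σ_j (β_{1−v_j,j}/a) e_{σ_j·v}; and R_k the matrix with (R_k)_{v,v} = −β_{v_k,k}, (R_k)_{v,σ_k·v} = −β_{1−v_k,k}, other entries 0. Then for every k ∈ {1,…,m}: R_k = (1 − c_k)·I_{2^m} + Σ_{v∈{0,1}^m, v_k = 0} β_{1,k}·Πβ_v·(C·(f_v − f_{σ_k·v})ᵀ)·(e_v − e_{σ_k·v}),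 where each summand is the outer product of the column vector C·(f_v − f_{σ_k·v})ᵀ with the row vector e_v − e_{σ_k·v}. -/

import Mathlib

open Finset
open scoped Classical

/-- `v_i ∈ {0,1}` regarded as a complex number. -/
noncomputable def bval (s : Bool) : ℂ := if s then 1 else 0

/-- The parameters `β_{0,i} = b_i`, `β_{1,i} = c_i − 1 − b_i`. -/
noncomputable def betaP {m : ℕ} (b c : Fin m → ℂ) (s : Bool) (i : Fin m) : ℂ :=
  if s then c i - 1 - b i else b i

/-- `σ_k·v` : flip the `k`-th coordinate of `v`. -/
def flipv {m : ℕ} (k : Fin m) (v : Fin m → Bool) : Fin m → Bool :=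
  Function.update v k (!(v k))

/-- The weight `|v| = Σ v_i` of `v ∈ {0,1}^m`. -/
def wt {m : ℕ} (v : Fin m → Bool) : ℕ := ∑ i, if v i then 1 else 0

/-- `γ_w = a − Σ_i w_i c_i + |w|`. -/
noncomputable def gammaP {m : ℕ} (a : ℂ) (c : Fin m → ℂ) (w : Fin m → Bool) : ℂ :=
  a - ∑ i, (if w i then c i else 0) + (wt w : ℂ)

/-- `A_w = Σ ∏_{j=1}^r 1/γ_{w^{(j)}}`, the sum over all chains
`w = w^{(r)} ≻ w^{(r−1)} ≻ ⋯ ≻ w^{(1)}` with `|w^{(j)}| = j` (here `r = |w|`;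
a chain is encoded as `ch : Fin r → {0,1}^m` with `ch j = w^{(j+1)}`, the conditions
on weights making the inclusions automatically strict);
for `w = (0,…,0)` the empty chain gives `A_w = 1`. -/
noncomputable def Aw {m : ℕ} (γ : (Fin m → Bool) → ℂ) (w : Fin m → Bool) : ℂ :=
  ∑ ch ∈ (univ : Finset (Fin (wt w) → Fin m → Bool)).filter
      (fun ch =>
        (∀ j : Fin (wt w), wt (ch j) = j.val + 1) ∧
        (∀ j : Fin (wt w), j.val = wt w - 1 → ch j = w) ∧
        (∀ j j' : Fin (wt w), j'.val = j.val + 1 →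
          ∀ i, ch j i = true → ch j' i = true)),
    ∏ j, 1 / γ (ch j)

/-- The intersection matrix `C` with entries
`C_{v,v'} = Σ_w A_w · ∏_{i : w_i = 0} δ(v_i, v'_i)/β_{v_i,i}`. -/
noncomputable def Cmat {m : ℕ} (a : ℂ) (b c : Fin m → ℂ) :
    Matrix (Fin m → Bool) (Fin m → Bool) ℂ :=
  fun v v' => ∑ w, Aw (gammaP a c) w *
    ∏ i ∈ univ.filter (fun i => w i = false),
      (if v i = v' i then 1 else 0) / betaP b c (v i) i

/-- `Σβ_v = Σ_i β_{v_i,i}`. -/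
noncomputable def Sbeta {m : ℕ} (b c : Fin m → ℂ) (v : Fin m → Bool) : ℂ :=
  ∑ i, betaP b c (v i) i

/-- `Πβ_v = ∏_i β_{v_i,i}`. -/
noncomputable def Pbeta {m : ℕ} (b c : Fin m → ℂ) (v : Fin m → Bool) : ℂ :=
  ∏ i, betaP b c (v i) i

/-- The standard basis row vector `e_v` of `ℂ^{2^m}`, `(e_v)_w = δ_{v,w}`. -/
noncomputable def evec {m : ℕ} (v : Fin m → Bool) : (Fin m → Bool) → ℂ :=
  fun w => if w = v then 1 else 0

/-- The coordinate row vector `f_v = ((a − Σβ_v)/a) e_v − Σ_j (β_{1−v_j,j}/a) e_{σ_j·v}`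
of the class `ψ_v` in the frame `(φ_v)`. -/
noncomputable def fvec {m : ℕ} (a : ℂ) (b c : Fin m → ℂ) (v : Fin m → Bool) :
    (Fin m → Bool) → ℂ :=
  ((a - Sbeta b c v) / a) • evec v - ∑ j, (betaP b c (!(v j)) j / a) • evec (flipv j v)

/-- The residue matrix `R_k`: `(R_k)_{v,v} = −β_{v_k,k}`, `(R_k)_{v,σ_k·v} = −β_{1−v_k,k}`,
all other entries `0`. -/
noncomputable def Rmat {m : ℕ} (b c : Fin m → ℂ) (k : Fin m) :
    Matrix (Fin m → Bool) (Fin m → Bool) ℂ :=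
  fun v w =>
    if w = v then -betaP b c (v k) k
    else if w = flipv k v then -betaP b c (!(v k)) k
    else 0

theorem wt_eq_card {m : ℕ} (v : Fin m → Bool) :
    wt v = (univ.filter fun i => v i = true).card := by
  simp [wt]

theorem flipv_flipv {m : ℕ} (k : Fin m) (v : Fin m → Bool) : flipv k (flipv k v) = v := by
  simp [flipv]

theorem flipv_self {m : ℕ} (k : Fin m) (v : Fin m → Bool) : flipv k v k = !(v k) := by
  simp [flipv]

theorem flipv_of_ne {m : ℕ} {k i : Fin m} (h : i ≠ k) (v : Fin m → Bool) :
    flipv k v i = v i := by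
  simp [flipv, h]

theorem flipv_ne {m : ℕ} (k : Fin m) (v : Fin m → Bool) : flipv k v ≠ v := by
  intro h
  have := congrFun h k
  simp [flipv_self] at this

theorem flipv_left_injective {m : ℕ} (v : Fin m → Bool) :
    Function.Injective fun k => flipv k v := by
  intro j k h
  by_contra hjk
  have := congrFun h j
  simp [flipv_self, flipv_of_ne hjk] at this

theorem wt_flipv {m : ℕ} {w : Fin m → Bool} {j : Fin m} (hj : w j = true) :
    wt w = wt (flipv j w) + 1 := by
  unfold wt
  rw [← Finset.add_sum_erase _ _ (mem_univ j), ← Finset.add_sum_erase _ _ (mem_univ j),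
    Finset.sum_congr rfl fun i hi => by rw [← flipv_of_ne (ne_of_mem_erase hi) w]]
  simp [flipv_self, hj, add_comm]

theorem exists_eq_flipv {m : ℕ} {x w : Fin m → Bool} (hle : ∀ i, x i = true → w i = true)
    (hwt : wt w = wt x + 1) : ∃ j, w j = true ∧ x = flipv j w := by
  rw [wt_eq_card, wt_eq_card] at hwt
  have hsub : (univ.filter fun i => x i = true) ⊆ univ.filter fun i => w i = true :=
    fun i hi => by simpa using hle i (by simpa using hi)
  have hcard := card_sdiff_of_subset hsub
  rw [hwt, Nat.add_sub_cancel_left, card_eq_one] at hcard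
  obtain ⟨j, hj⟩ := hcard
  have hmem : ∀ i, (w i = true ∧ x i = false) ↔ i = j := fun i => by
    simpa using congrArg (i ∈ ·) hj
  refine ⟨j, ((hmem j).2 rfl).1, funext fun i => ?_⟩
  by_cases hij : i = j
  · subst hij
    simp [flipv_self, (hmem i).2 rfl]
  · rw [flipv_of_ne hij]
    have h1 := hle i
    have h2 := mt (hmem i).1 hij
    revert h1 h2
    cases x i <;> cases w i <;> simp

/-- The chains of length `r` ending at `w`. -/
noncomputable def chains {m : ℕ} (r : ℕ) (w : Fin m → Bool) : Finset (Fin r → Fin m → Bool) :=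
  univ.filter fun ch =>
    (∀ j : Fin r, wt (ch j) = j.val + 1) ∧
    (∀ j : Fin r, j.val = r - 1 → ch j = w) ∧
    (∀ j j' : Fin r, j'.val = j.val + 1 → ∀ i, ch j i = true → ch j' i = true)

theorem Aw_eq_sum_chains {m : ℕ} (γ : (Fin m → Bool) → ℂ) {w : Fin m → Bool} {r : ℕ}
    (h : wt w = r) : Aw γ w = ∑ ch ∈ chains r w, ∏ j, 1 / γ (ch j) := by
  subst h
  rfl

theorem mem_chains_succ {m r : ℕ} {w : Fin m → Bool} {ch : Fin (r + 1) → Fin m → Bool} :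
    ch ∈ chains (r + 1) w ↔ (∀ j, wt (ch j) = j.val + 1) ∧ ch (Fin.last r) = w ∧
      ∀ (j : Fin r) i, ch j.castSucc i = true → ch j.succ i = true := by
  simp only [chains, mem_filter, mem_univ, true_and]
  refine and_congr_right fun _ => and_congr ⟨fun h => h _ (by simp), fun h j hj => ?_⟩
    ⟨fun h j => h _ _ (by simp), fun h j j' hj => ?_⟩
  · rwa [show j = Fin.last r from Fin.ext (by simpa using hj)]
  · have hlt : j.val < r := by omega
    have := h ⟨j, hlt⟩
    rwa [show (⟨j, hlt⟩ : Fin r).castSucc = j from rfl,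
      show (⟨j, hlt⟩ : Fin r).succ = j' from Fin.ext (by simp [hj])] at this

theorem Aw_of_wt_eq_zero {m : ℕ} (γ : (Fin m → Bool) → ℂ) {w : Fin m → Bool}
    (h : wt w = 0) : Aw γ w = 1 := by
  rw [Aw_eq_sum_chains γ h]
  simp [chains]

theorem snoc_mem_chains {m r : ℕ} {w : Fin m → Bool} (hw : wt w = r + 2)
    {ch : Fin (r + 1) → Fin m → Bool} :
    Fin.snoc (α := fun _ => Fin m → Bool) ch w ∈ chains (r + 2) w ↔
      ∃ j, w j = true ∧ ch ∈ chains (r + 1) (flipv j w) := by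
  have hstep : (∀ (j : Fin (r + 1)) i,
      Fin.snoc (α := fun _ => Fin m → Bool) ch w j.castSucc i = true →
        Fin.snoc (α := fun _ => Fin m → Bool) ch w j.succ i = true) ↔
      (∀ (j : Fin r) i, ch j.castSucc i = true → ch j.succ i = true) ∧
        ∀ i, ch (Fin.last r) i = true → w i = true := by
    rw [Fin.forall_fin_succ']
    simp only [Fin.succ_castSucc, Fin.succ_last, Fin.snoc_castSucc, Fin.snoc_last]
  simp only [mem_chains_succ]
  rw [Fin.forall_fin_succ', hstep]
  simp only [Fin.snoc_castSucc, Fin.snoc_last, Fin.val_castSucc, Fin.val_last, hw, true_and,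
    and_true]
  constructor
  · rintro ⟨h1, h2, h3⟩
    obtain ⟨j, hj, hx⟩ := exists_eq_flipv h3 (by rw [hw, h1]; simp)
    exact ⟨j, hj, h1, hx, h2⟩
  · rintro ⟨j, hj, h1, hx, h2⟩
    refine ⟨h1, h2, fun i => ?_⟩
    rw [hx]
    by_cases hij : i = j
    · simp [hij, hj]
    · simp [flipv_of_ne hij]

/-- Removing the top element of a chain. -/
theorem gamma_mul_Aw {m : ℕ} {γ : (Fin m → Bool) → ℂ} (hγ : ∀ w, γ w ≠ 0)
    {w : Fin m → Bool} (hw : wt w ≠ 0) :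
    γ w * Aw γ w = ∑ j, if w j = true then Aw γ (flipv j w) else 0 := by
  obtain ⟨r, hr⟩ := Nat.exists_eq_succ_of_ne_zero hw
  rw [← Finset.sum_filter]
  rcases r with _ | r
  · have hsing : chains 1 w = {fun _ => w} := by
      ext ch
      rw [mem_chains_succ, mem_singleton]
      constructor
      · rintro ⟨-, h, -⟩
        funext j
        rw [Subsingleton.elim j (Fin.last 0), h]
      · rintro rfl
        simp [hr]
    rw [Aw_eq_sum_chains γ hr, hsing, sum_congr rfl fun j hj => Aw_of_wt_eq_zero γ (by
      have := wt_flipv (mem_filter.1 hj).2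
      omega)]
    rw [sum_const, ← wt_eq_card, hr]
    simp [hγ w]
  · have hflip : ∀ j ∈ univ.filter fun j => w j = true, Aw γ (flipv j w) =
        ∑ ch ∈ chains (r + 1) (flipv j w), ∏ i, 1 / γ (ch i) := fun j hj =>
      Aw_eq_sum_chains γ (by have := wt_flipv (mem_filter.1 hj).2; omega)
    rw [Aw_eq_sum_chains γ hr, sum_congr rfl hflip, sum_sigma', mul_sum]
    symm
    refine sum_bij (fun p _ => Fin.snoc (α := fun _ => Fin m → Bool) p.2 w) ?_ ?_ ?_ ?_
    · rintro ⟨j, ch⟩ h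
      simp only [mem_sigma, mem_filter, mem_univ, true_and] at h
      exact (snoc_mem_chains hr).2 ⟨j, h⟩
    · rintro ⟨j, ch⟩ h ⟨j', ch'⟩ h' heq
      simp only [mem_sigma, mem_chains_succ] at h h'
      obtain rfl : ch = ch' := (Fin.snoc_inj.1 heq).1
      obtain rfl : j = j' := flipv_left_injective w (h.2.2.1.symm.trans h'.2.2.1)
      rfl
    · intro ch h
      have hlast := (mem_chains_succ.1 h).2.1
      have hsnoc : Fin.snoc (α := fun _ => Fin m → Bool) (Fin.init ch) w = ch := by
        rw [← hlast]
        exact Fin.snoc_init_self ch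
      rw [← hsnoc] at h
      obtain ⟨j, hj⟩ := (snoc_mem_chains hr).1 h
      exact ⟨⟨j, Fin.init ch⟩, by simpa using hj, hsnoc⟩
    · rintro ⟨j, ch⟩ -
      rw [Fin.prod_univ_castSucc (n := r + 1)]
      simp only [Fin.snoc_castSucc, Fin.snoc_last]
      field_simp [hγ w]

/-- The factor `∏_{i : w_i = 0} δ(u_i, v_i)/β_{u_i,i}` of the entries of `Cmat`. -/
noncomputable def deltaProd {m : ℕ} (b c : Fin m → ℂ) (w u v : Fin m → Bool) : ℂ :=
  ∏ i ∈ univ.filter (fun i => w i = false), (if u i = v i then 1 else 0) / betaP b c (u i) i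

theorem deltaProd_eq_mul_flipv {m : ℕ} (b c : Fin m → ℂ) {w : Fin m → Bool} {j : Fin m}
    (hj : w j = false) (u v : Fin m → Bool) :
    deltaProd b c w u v =
      (if u j = v j then 1 else 0) / betaP b c (u j) j * deltaProd b c (flipv j w) u v := by
  have hfilter : (univ.filter fun i => w i = false) =
      insert j (univ.filter fun i => flipv j w i = false) := by
    ext i
    by_cases hij : i = j
    · simp [hij, hj]
    · simp [hij, flipv_of_ne hij]
  rw [deltaProd, hfilter, prod_insert (by simp [flipv_self, hj]), deltaProd]

theorem deltaProd_flipv_right {m : ℕ} (b c : Fin m → ℂ) {w : Fin m → Bool} {j : Fin m}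
    (hj : w j = true) (u v : Fin m → Bool) :
    deltaProd b c w u (flipv j v) = deltaProd b c w u v := by
  refine prod_congr rfl fun i hi => ?_
  rw [flipv_of_ne]
  rintro rfl
  simp [hj] at hi

theorem betaP_mul_deltaProd_add {m : ℕ} {b c : Fin m → ℂ} (hβ : ∀ s i, betaP b c s i ≠ 0)
    {w : Fin m → Bool} {j : Fin m} (hj : w j = false) (u v : Fin m → Bool) :
    betaP b c (v j) j * deltaProd b c w u v +
      betaP b c (!(v j)) j * deltaProd b c w u (flipv j v) = deltaProd b c (flipv j w) u v := by
  rw [deltaProd_eq_mul_flipv b c hj u v, deltaProd_eq_mul_flipv b c hj u (flipv j v),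
    deltaProd_flipv_right b c (by simp [flipv_self, hj]), flipv_self]
  have h0 := hβ false j
  have h1 := hβ true j
  cases u j <;> cases v j <;> simp <;> field_simp

theorem deltaProd_false {m : ℕ} (b c : Fin m → ℂ) (u v : Fin m → Bool) :
    deltaProd b c (fun _ => false) u v = evec v u / Pbeta b c v := by
  rw [deltaProd, evec]
  split_ifs with h
  · simp [h, Pbeta]
  · obtain ⟨i, hi⟩ := Function.ne_iff.1 h
    rw [zero_div]
    exact prod_eq_zero (i := i) (by simp) (by simp [hi])

theorem gammaP_eq {m : ℕ} (a : ℂ) (b c : Fin m → ℂ) (w v : Fin m → Bool) :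
    gammaP a c w = a - ∑ j, if w j = true then
      betaP b c (v j) j + betaP b c (!(v j)) j else 0 := by
  rw [gammaP, wt]
  push_cast
  rw [sub_add, ← sum_sub_distrib]
  congr 1
  refine sum_congr rfl fun j _ => ?_
  cases w j <;> cases v j <;> simp [betaP]

theorem sum_flipv {m : ℕ} (j : Fin m) (f : (Fin m → Bool) → ℂ) :
    ∑ w, f (flipv j w) = ∑ w, f w :=
  Equiv.sum_comp (Function.Involutive.toPerm (flipv j) (flipv_flipv j)) f

theorem sum_mul_evec {m : ℕ} (f : (Fin m → Bool) → ℂ) (v : Fin m → Bool) :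
    ∑ w, f w * evec v w = f v := by
  simp [evec]

theorem deltaProd_combination {m : ℕ} (a : ℂ) {b c : Fin m → ℂ}
    (hβ : ∀ s i, betaP b c s i ≠ 0) (w u v : Fin m → Bool) :
    (a - Sbeta b c v) * deltaProd b c w u v -
        ∑ j, betaP b c (!(v j)) j * deltaProd b c w u (flipv j v) =
      gammaP a c w * deltaProd b c w u v -
        ∑ j, if w j = false then deltaProd b c (flipv j w) u v else 0 := by
  rw [gammaP_eq a b c w v, Sbeta, sub_mul, sub_mul, sum_mul, sum_mul, sub_sub, sub_sub,
    ← sum_add_distrib, ← sum_add_distrib]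
  congr 1
  refine sum_congr rfl fun j _ => ?_
  cases hj : w j
  · simp [betaP_mul_deltaProd_add hβ hj]
  · rw [deltaProd_flipv_right b c hj]
    simp [add_mul]

/-- The classes `ψ_v` are dual, up to the factor `Πβ_v`, to the frame `φ_v`. -/
theorem Cmat_mul_fvec {m : ℕ} {a : ℂ} {b c : Fin m → ℂ} (ha : a ≠ 0)
    (hβ : ∀ s i, betaP b c s i ≠ 0) (hγ : ∀ w : Fin m → Bool, gammaP a c w ≠ 0)
    (u v : Fin m → Bool) :
    ∑ w, Cmat a b c u w * fvec a b c v w = evec v u / Pbeta b c v := by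
  have hC : ∀ v', Cmat a b c u v' = ∑ w, Aw (gammaP a c) w * deltaProd b c w u v' :=
    fun _ => rfl
  have hexpand : ∑ w, Cmat a b c u w * fvec a b c v w =
      (a - Sbeta b c v) / a * Cmat a b c u v -
        ∑ j, betaP b c (!(v j)) j / a * Cmat a b c u (flipv j v) := by
    simp only [fvec, Pi.sub_apply, Pi.smul_apply, Finset.sum_apply, smul_eq_mul, mul_sub,
      sum_sub_distrib, mul_sum]
    rw [sum_comm]
    simp only [mul_left_comm (Cmat a b c u _), ← mul_sum, sum_mul_evec]
  have hdouble : ∑ w, Aw (gammaP a c) w *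
        ∑ j, (if w j = false then deltaProd b c (flipv j w) u v else 0) =
      ∑ w, (∑ j, if w j = true then Aw (gammaP a c) (flipv j w) else 0) *
        deltaProd b c w u v := by
    simp only [mul_sum, sum_mul]
    rw [sum_comm, sum_comm (γ := Fin m → Bool)]
    refine sum_congr rfl fun j _ => ?_
    rw [← sum_flipv j]
    refine sum_congr rfl fun w _ => ?_
    rw [flipv_self, flipv_flipv]
    cases w j <;> simp
  have hmain : a * ∑ w, Cmat a b c u w * fvec a b c v w =
      ∑ w, (gammaP a c w * Aw (gammaP a c) w -
        ∑ j, if w j = true then Aw (gammaP a c) (flipv j w) else 0) *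
          deltaProd b c w u v := by
    simp only [sub_mul, sum_sub_distrib]
    rw [← hdouble, ← sum_sub_distrib, hexpand, mul_sub, mul_sum]
    simp only [← mul_assoc, mul_div_cancel₀ _ ha, hC]
    simp only [mul_sum]
    rw [sum_comm, ← sum_sub_distrib]
    refine sum_congr rfl fun w _ => ?_
    have := congrArg (Aw (gammaP a c) w * ·) (deltaProd_combination a hβ w u v)
    simp only [mul_sub, mul_sum] at this
    simp only [mul_left_comm _ (Aw (gammaP a c) w), mul_assoc, sub_mul, mul_sub] at this ⊢
    linear_combination this
  have hzero : wt (fun _ : Fin m => false) = 0 := by simp [wt]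
  refine mul_left_cancel₀ ha (hmain.trans ?_)
  rw [sum_eq_single fun _ => false]
  · rw [deltaProd_false, Aw_of_wt_eq_zero _ hzero]
    simp [gammaP, hzero]
  · intro w _ hw
    rw [gamma_mul_Aw hγ, sub_self, zero_mul]
    intro h
    rw [wt_eq_card, card_eq_zero, filter_eq_empty_iff] at h
    exact hw (funext fun i => by simpa using h (mem_univ i))
  · simp

theorem Pbeta_flipv {m : ℕ} (b c : Fin m → ℂ) (k : Fin m) (v : Fin m → Bool) :
    betaP b c (v k) k * Pbeta b c (flipv k v) = betaP b c (!(v k)) k * Pbeta b c v := by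
  rw [Pbeta, Pbeta, ← mul_prod_erase _ _ (mem_univ k), ← mul_prod_erase _ _ (mem_univ k),
    prod_congr rfl fun i hi => by rw [flipv_of_ne (ne_of_mem_erase hi)], flipv_self]
  ring

theorem sum_filter_mul_evec_sub {m : ℕ} (k : Fin m) (g : (Fin m → Bool) → ℂ)
    (w : Fin m → Bool) :
    ∑ v ∈ univ.filter (fun v : Fin m → Bool => v k = false),
        g v * (evec v w - evec (flipv k v) w) =
      if w k = false then g w else -g (flipv k w) := by
  have hflip : ∀ v, w = flipv k v ↔ flipv k w = v := fun v =>
    ⟨fun h => by rw [h, flipv_flipv], fun h => by rw [← h, flipv_flipv]⟩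
  simp only [evec, hflip, mul_sub, sum_sub_distrib, mul_ite, mul_one, mul_zero, sum_ite_eq,
    mem_filter, mem_univ, true_and, flipv_self]
  cases w k <;> simp

/-- **Lemma 4.8(i), matrix form.** For every `k`:
`R_k = (1 − c_k)·I + Σ_{v_k=0} β_{1,k}·Πβ_v·(C·(f_v − f_{σ_k·v})ᵀ)·(e_v − e_{σ_k·v})`,
each summand being the outer product of the column vector `C·(f_v − f_{σ_k·v})ᵀ`
with the row vector `e_v − e_{σ_k·v}`. -/
theorem stmt_14 (m : ℕ) (hm : 1 ≤ m) (a : ℂ) (b c : Fin m → ℂ) (ha : a ≠ 0)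
    (hb0 : ∀ i, betaP b c false i ≠ 0) (hb1 : ∀ i, betaP b c true i ≠ 0)
    (hγ : ∀ w : Fin m → Bool, gammaP a c w ≠ 0) (k : Fin m) :
    Rmat b c k =
      (1 - c k) • (1 : Matrix (Fin m → Bool) (Fin m → Bool) ℂ) +
        ∑ v ∈ univ.filter (fun v : Fin m → Bool => v k = false),
          (betaP b c true k * Pbeta b c v) •
            Matrix.vecMulVec
              (fun u => ∑ w, Cmat a b c u w * (fvec a b c v w - fvec a b c (flipv k v) w))
              (evec v - evec (flipv k v)) := by
  have hβ : ∀ s i, betaP b c s i ≠ 0 := fun s i => by cases s; exacts [hb0 i, hb1 i]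
  have hP : ∀ v, Pbeta b c v ≠ 0 := fun v => prod_ne_zero_iff.2 fun i _ => hβ _ i
  have hC : ∀ u v, ∑ w, Cmat a b c u w * (fvec a b c v w - fvec a b c (flipv k v) w) =
      evec v u / Pbeta b c v - evec (flipv k v) u / Pbeta b c (flipv k v) := fun u v => by
    simp only [mul_sub, sum_sub_distrib, Cmat_mul_fvec ha hβ hγ]
  ext u w
  simp only [Matrix.add_apply, Matrix.smul_apply, Matrix.sum_apply, Matrix.vecMulVec_apply, hC,
    Matrix.one_apply, Pi.sub_apply, smul_eq_mul, Rmat, ← mul_assoc, sum_filter_mul_evec_sub,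
    flipv_flipv]
  have hflip := Pbeta_flipv b c k w
  have hw := hP w
  have hw' := hP (flipv k w)
  have hsum : c k = 1 + betaP b c false k + betaP b c true k := by simp [betaP]
  by_cases huw : u = w
  · subst huw
    have hne := (flipv_ne k u).symm
    cases huk : u k <;> simp [huk] at hflip <;> simp [evec, hne, hsum, hw, mul_assoc]
    · ring
    · field_simp
      linear_combination -hflip
  · by_cases huw' : u = flipv k w
    · subst huw'
      have hne := (flipv_ne k w).symm
      cases hwk : w k <;> simp [hwk] at hflip <;>
        simp [evec, flipv_flipv, flipv_self, hwk, hne, hne.symm] <;> field_simp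
      all_goals linear_combination hflip
    · have hwu : w ≠ flipv k u := fun h => huw' (by rw [h, flipv_flipv])
      simp [evec, huw, huw', hwu, Ne.symm huw]
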